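/- Let A be a Hermitian n×n matrix over the split quaternion algebra H with det A ≠ 0, let y = (y_1,…,y_n)ᵀ be a column vector over H, and consider the right system of linear equations A·x = y in the unknown column vector x = (x_1,…,x_n)ᵀ. Then this system has a unique solution, given componentwise by Cramer's rule x_j = cdet_j A_{.j}(y) / det A for each j = 1,…,n, where A_{.j}(y) is the matrix obtained from A by replacing its j-th column with y. -/

import Mathlib

/-- The split quaternion (coquaternion) algebra over ℝ:
`i² = −1`, `j² = 1`, `k² = 1`, `ij = −ji = k`. -/
abbrev SplitQuaternion : Type := QuaternionAlgebra ℝ (-1) 0 1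

noncomputable section

namespace SplitQuaternion

variable {n : ℕ}

/-- The ordered product of entries of `A` along the cycle of `σ` containing `s`,
read in the "row" direction:
`a_{s, σ s} * a_{σ s, σ² s} * ⋯ * a_{σ^{L−1} s, s}` where `L` is the cycle length. -/
def rowCycleProd (A : Matrix (Fin n) (Fin n) SplitQuaternion) (σ : Equiv.Perm (Fin n))
    (s : Fin n) : SplitQuaternion :=
  ((List.range (Function.minimalPeriod σ s)).map
    (fun m => A ((σ ^ m) s) ((σ ^ (m + 1)) s))).prod

/-- The ordered product of entries of `A` along the cycle of `σ` containing `s`,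
read in the "column" direction:
`a_{s, σ^{L−1} s} * ⋯ * a_{σ² s, σ s} * a_{σ s, s}` where `L` is the cycle length. -/
def colCycleProd (A : Matrix (Fin n) (Fin n) SplitQuaternion) (σ : Equiv.Perm (Fin n))
    (s : Fin n) : SplitQuaternion :=
  (((List.range (Function.minimalPeriod σ s)).map
    (fun m => A ((σ ^ (m + 1)) s) ((σ ^ m) s))).reverse).prod

open scoped Classical in
/-- The least elements of the cycles of `σ` other than the cycle containing `i`,
listed in increasing order. -/
def otherCycleMins (σ : Equiv.Perm (Fin n)) (i : Fin n) : List (Fin n) :=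
  (Finset.univ.filter (fun s : Fin n =>
    (∀ t, σ.SameCycle s t → s ≤ t) ∧ ¬ σ.SameCycle i s)).sort (· ≤ ·)

/-- The `i`-th row determinant of `A`: the sum over all permutations `σ` of
`(−1)^{n−r}` (which is `sign σ`, `r` being the number of disjoint cycles of `σ`,
fixed points included) times the product of the entries of `A` ordered according to
the left-ordered cycle notation of `σ` whose first cycle starts with `i`, every
other cycle starting with its least element, the cycles being ordered by
increasing least elements. -/
def rdet (A : Matrix (Fin n) (Fin n) SplitQuaternion) (i : Fin n) : SplitQuaternion :=
  ∑ σ : Equiv.Perm (Fin n),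
    ((Equiv.Perm.sign σ : ℤ) : SplitQuaternion) *
      (rowCycleProd A σ i * ((otherCycleMins σ i).map (rowCycleProd A σ)).prod)

/-- The `j`-th column determinant of `A`: the sum over all permutations `τ` of
`(−1)^{n−r}` times the product of the entries of `A` ordered according to the
right-ordered cycle notation of `τ` whose rightmost cycle ends with `j`, every
other cycle ending with its least element, the cycles being ordered (from right
to left) by increasing least elements. -/
def cdet (A : Matrix (Fin n) (Fin n) SplitQuaternion) (j : Fin n) : SplitQuaternion :=
  ∑ σ : Equiv.Perm (Fin n),
    ((Equiv.Perm.sign σ : ℤ) : SplitQuaternion) *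
      ((((otherCycleMins σ j).reverse).map (colCycleProd A σ)).prod * colCycleProd A σ j)

/-- The determinant of a Hermitian matrix: the common value of all row and column
determinants (here given as `rdet` at the index `0`). -/
def hdet [NeZero n] (A : Matrix (Fin n) (Fin n) SplitQuaternion) : SplitQuaternion :=
  rdet A 0


/-- If `τ` agrees with `σ` on the cycle of `s`, then the orbits of `s` coincide. -/
theorem pow_apply_congr {σ τ : Equiv.Perm (Fin n)} {s : Fin n}
    (h : ∀ x, σ.SameCycle s x → τ x = σ x) (m : ℕ) : (τ ^ m) s = (σ ^ m) s := by
  induction m with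
  | zero => rfl
  | succ m ih =>
    rw [pow_succ', pow_succ', Equiv.Perm.mul_apply, Equiv.Perm.mul_apply, ih]
    exact h _ (Equiv.Perm.sameCycle_pow_right.2 (Equiv.Perm.SameCycle.refl _ _))

theorem sameCycle_congr {σ τ : Equiv.Perm (Fin n)} {s : Fin n}
    (h : ∀ m : ℕ, (τ ^ m) s = (σ ^ m) s) (t : Fin n) : τ.SameCycle s t ↔ σ.SameCycle s t := by
  constructor
  · intro H
    obtain ⟨m, rfl⟩ := H.exists_nat_pow_eq
    rw [h]
    exact Equiv.Perm.sameCycle_pow_right.2 (Equiv.Perm.SameCycle.refl _ _)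
  · intro H
    obtain ⟨m, rfl⟩ := H.exists_nat_pow_eq
    rw [← h]
    exact Equiv.Perm.sameCycle_pow_right.2 (Equiv.Perm.SameCycle.refl _ _)

theorem pow_apply_eq_iterate (σ : Equiv.Perm (Fin n)) (m : ℕ) (s : Fin n) :
    (σ ^ m) s = σ^[m] s := by
  rw [Equiv.Perm.iterate_eq_pow]

theorem minimalPeriod_pos (σ : Equiv.Perm (Fin n)) (s : Fin n) :
    0 < Function.minimalPeriod σ s := by
  apply Function.IsPeriodicPt.minimalPeriod_pos (orderOf_pos σ)
  rw [Function.IsPeriodicPt, Function.IsFixedPt, Equiv.Perm.iterate_eq_pow, pow_orderOf_eq_one]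
  rfl

theorem pow_minimalPeriod_apply (σ : Equiv.Perm (Fin n)) (s : Fin n) :
    (σ ^ Function.minimalPeriod σ s) s = s := by
  rw [pow_apply_eq_iterate, Function.iterate_minimalPeriod]

theorem minimalPeriod_congr {σ τ : Equiv.Perm (Fin n)} {s : Fin n}
    (h : ∀ m : ℕ, (τ ^ m) s = (σ ^ m) s) :
    Function.minimalPeriod τ s = Function.minimalPeriod σ s := by
  rw [Function.minimalPeriod_eq_minimalPeriod_iff]
  intro m
  simp only [Function.IsPeriodicPt, Function.IsFixedPt, ← pow_apply_eq_iterate, h]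

theorem colCycleProd_congr {A B : Matrix (Fin n) (Fin n) SplitQuaternion}
    {σ τ : Equiv.Perm (Fin n)} {s : Fin n} (h : ∀ m : ℕ, (τ ^ m) s = (σ ^ m) s)
    (hAB : ∀ x y, σ.SameCycle s y → B x y = A x y) :
    colCycleProd B τ s = colCycleProd A σ s := by
  unfold colCycleProd
  rw [minimalPeriod_congr h]
  simp only [h]
  congr 3
  funext m
  exact hAB _ _ (Equiv.Perm.sameCycle_pow_right.2 (Equiv.Perm.SameCycle.refl _ _))

theorem colCycleProd_updateCol_of_not_sameCycle (A : Matrix (Fin n) (Fin n) SplitQuaternion)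
    (y : Fin n → SplitQuaternion) {σ : Equiv.Perm (Fin n)} {j s : Fin n}
    (h : ¬ σ.SameCycle j s) :
    colCycleProd (A.updateCol j y) σ s = colCycleProd A σ s := by
  refine colCycleProd_congr (fun _ => rfl) fun x t ht => Matrix.updateCol_ne ?_
  rintro rfl
  exact h ht.symm

/-- The product along a cycle without the entry lying in column `j`. -/
def cyclePath (A : Matrix (Fin n) (Fin n) SplitQuaternion) (σ : Equiv.Perm (Fin n))
    (j : Fin n) : SplitQuaternion :=
  (((List.range (Function.minimalPeriod σ j - 1)).map
    (fun m => A ((σ ^ (m + 2)) j) ((σ ^ (m + 1)) j))).reverse).prod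

theorem colCycleProd_eq_cyclePath_mul (A : Matrix (Fin n) (Fin n) SplitQuaternion)
    (σ : Equiv.Perm (Fin n)) (j : Fin n) :
    colCycleProd A σ j = cyclePath A σ j * A (σ j) j := by
  obtain ⟨L, hL⟩ := Nat.exists_eq_succ_of_ne_zero (minimalPeriod_pos σ j).ne'
  simp [colCycleProd, cyclePath, hL, List.range_succ_eq_map, Function.comp_def]

theorem cyclePath_updateCol (A : Matrix (Fin n) (Fin n) SplitQuaternion)
    (y : Fin n → SplitQuaternion) (σ : Equiv.Perm (Fin n)) (j : Fin n) :
    cyclePath (A.updateCol j y) σ j = cyclePath A σ j := by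
  unfold cyclePath
  congr 2
  refine List.map_congr_left fun m hm => Matrix.updateCol_ne fun h => ?_
  rw [List.mem_range] at hm
  refine Function.not_isPeriodicPt_of_pos_of_lt_minimalPeriod (Nat.succ_ne_zero m)
    (by omega : m + 1 < Function.minimalPeriod σ j) ?_
  rwa [Function.IsPeriodicPt, Function.IsFixedPt, ← pow_apply_eq_iterate]

theorem colCycleProd_updateCol (A : Matrix (Fin n) (Fin n) SplitQuaternion)
    (y : Fin n → SplitQuaternion) (σ : Equiv.Perm (Fin n)) (j : Fin n) :
    colCycleProd (A.updateCol j y) σ j = cyclePath A σ j * y (σ j) := by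
  rw [colCycleProd_eq_cyclePath_mul, cyclePath_updateCol, Matrix.updateCol_self]

theorem colCycleProd_apply (A : Matrix (Fin n) (Fin n) SplitQuaternion)
    (σ : Equiv.Perm (Fin n)) (s : Fin n) :
    colCycleProd A σ (σ s) = A (σ s) s * cyclePath A σ s := by
  have hp : Function.minimalPeriod σ (σ s) = Function.minimalPeriod σ s :=
    Function.minimalPeriod_apply (Function.minimalPeriod_pos_iff_mem_periodicPts.1
      (minimalPeriod_pos σ s))
  have h := pow_minimalPeriod_apply σ s
  obtain ⟨L, hL⟩ := Nat.exists_eq_succ_of_ne_zero (minimalPeriod_pos σ s).ne'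
  have key : ∀ m : ℕ, (σ ^ m) (σ s) = (σ ^ (m + 1)) s := fun m => by
    rw [pow_succ, Equiv.Perm.mul_apply]
  rw [hL, Nat.succ_eq_add_one] at h
  simp only [colCycleProd, cyclePath, hp, hL, key, List.range_succ, Nat.succ_eq_add_one,
    List.map_append, List.reverse_append, List.prod_append, Nat.add_sub_cancel]
  simp only [List.map_cons, List.map_nil, List.reverse_singleton, List.prod_singleton, h]
  rw [pow_succ', Equiv.Perm.mul_apply, h]

theorem re_mul_comm (a b : SplitQuaternion) : (a * b).re = (b * a).re := by
  simp only [QuaternionAlgebra.re_mul]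
  ring

theorem add_star_eq (a : SplitQuaternion) :
    a + star a = algebraMap ℝ SplitQuaternion (2 * a.re) := by
  rw [QuaternionAlgebra.self_add_star', zero_mul, add_zero, QuaternionAlgebra.coe_algebraMap]

theorem re_colCycleProd_of_sameCycle (A : Matrix (Fin n) (Fin n) SplitQuaternion)
    {σ : Equiv.Perm (Fin n)} {s t : Fin n} (h : σ.SameCycle s t) :
    (colCycleProd A σ t).re = (colCycleProd A σ s).re := by
  obtain ⟨m, rfl⟩ := h.exists_nat_pow_eq
  clear h
  induction m with
  | zero => rfl
  | succ m ih =>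
    rw [pow_succ', Equiv.Perm.mul_apply, colCycleProd_apply, re_mul_comm,
      ← colCycleProd_eq_cyclePath_mul, ih]

theorem star_rowCycleProd {A : Matrix (Fin n) (Fin n) SplitQuaternion} (hA : A.IsHermitian)
    (σ : Equiv.Perm (Fin n)) (s : Fin n) :
    star (rowCycleProd A σ s) = colCycleProd A σ s := by
  have hs : ∀ l : List SplitQuaternion, star l.prod = ((l.map star).reverse).prod := by
    intro l
    induction l with
    | nil => simp
    | cons a l ih => simp [ih]
  rw [rowCycleProd, hs, List.map_map, colCycleProd]
  congr 3
  funext m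
  exact hA.apply _ _

theorem rowCycleProd_inv (A : Matrix (Fin n) (Fin n) SplitQuaternion)
    (σ : Equiv.Perm (Fin n)) (s : Fin n) :
    rowCycleProd A σ⁻¹ s = colCycleProd A σ s := by
  have key : ∀ m ≤ Function.minimalPeriod σ s,
      (σ⁻¹ ^ m) s = (σ ^ (Function.minimalPeriod σ s - m)) s := by
    intro m hm
    rw [inv_pow, Equiv.Perm.inv_eq_iff_eq, ← Equiv.Perm.mul_apply, ← pow_add,
      Nat.add_sub_cancel' hm, pow_minimalPeriod_apply]
  have hp : Function.minimalPeriod (σ⁻¹ : Equiv.Perm (Fin n)) s = Function.minimalPeriod σ s := by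
    rw [Function.minimalPeriod_eq_minimalPeriod_iff]
    intro m
    simp only [Function.IsPeriodicPt, Function.IsFixedPt, ← pow_apply_eq_iterate]
    rw [inv_pow, Equiv.Perm.inv_eq_iff_eq, eq_comm]
  unfold rowCycleProd colCycleProd
  rw [hp]
  congr 1
  refine List.ext_getElem (by simp) fun m hm _ => ?_
  rw [List.length_map, List.length_range] at hm
  simp only [List.getElem_map, List.getElem_range, List.getElem_reverse, List.length_map,
    List.length_range]
  rw [key m hm.le, key (m + 1) hm,
    show Function.minimalPeriod σ s - m = Function.minimalPeriod σ s - 1 - m + 1 by omega,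
    show Function.minimalPeriod σ s - (m + 1) = Function.minimalPeriod σ s - 1 - m by omega]

/-- The permutation obtained from `σ` by inverting the cycle containing `s`. -/
def revCycle (σ : Equiv.Perm (Fin n)) (s : Fin n) : Equiv.Perm (Fin n) :=
  σ * (σ.cycleOf s)⁻¹ * (σ.cycleOf s)⁻¹

theorem revCycle_apply_of_sameCycle {σ : Equiv.Perm (Fin n)} {s x : Fin n}
    (h : σ.SameCycle s x) : revCycle σ s x = σ⁻¹ x := by
  have h' : σ⁻¹.SameCycle s x := Equiv.Perm.sameCycle_inv.2 h
  have h'' : σ⁻¹.SameCycle s (σ⁻¹ x) := Equiv.Perm.sameCycle_apply_right.2 h'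
  simp only [revCycle, Equiv.Perm.mul_apply, Equiv.Perm.cycleOf_inv]
  rw [h'.cycleOf_apply, h''.cycleOf_apply]
  exact σ.apply_symm_apply _

theorem revCycle_apply_of_not_sameCycle {σ : Equiv.Perm (Fin n)} {s x : Fin n}
    (h : ¬ σ.SameCycle s x) : revCycle σ s x = σ x := by
  have h' : ¬ σ⁻¹.SameCycle s x := fun H => h (Equiv.Perm.sameCycle_inv.1 H)
  simp only [revCycle, Equiv.Perm.mul_apply, Equiv.Perm.cycleOf_inv]
  rw [Equiv.Perm.cycleOf_apply_of_not_sameCycle h',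
    Equiv.Perm.cycleOf_apply_of_not_sameCycle h']

theorem sign_revCycle (σ : Equiv.Perm (Fin n)) (s : Fin n) :
    Equiv.Perm.sign (revCycle σ s) = Equiv.Perm.sign σ := by
  rw [revCycle, mul_assoc, map_mul, map_mul, Int.units_mul_self, mul_one]

theorem pow_revCycle_of_sameCycle {σ : Equiv.Perm (Fin n)} {s x : Fin n}
    (h : σ.SameCycle s x) (m : ℕ) : (revCycle σ s ^ m) x = (σ⁻¹ ^ m) x :=
  pow_apply_congr (fun _ hy => revCycle_apply_of_sameCycle
    (h.trans (Equiv.Perm.sameCycle_inv.1 hy))) m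

theorem pow_revCycle_of_not_sameCycle {σ : Equiv.Perm (Fin n)} {s x : Fin n}
    (h : ¬ σ.SameCycle s x) (m : ℕ) : (revCycle σ s ^ m) x = (σ ^ m) x :=
  pow_apply_congr (fun _ hy => revCycle_apply_of_not_sameCycle
    fun H => h (H.trans hy.symm)) m

theorem sameCycle_revCycle (σ : Equiv.Perm (Fin n)) (s x y : Fin n) :
    (revCycle σ s).SameCycle x y ↔ σ.SameCycle x y := by
  by_cases h : σ.SameCycle s x
  · rw [sameCycle_congr (pow_revCycle_of_sameCycle h), Equiv.Perm.sameCycle_inv]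
  · rw [sameCycle_congr (pow_revCycle_of_not_sameCycle h)]

theorem revCycle_revCycle (σ : Equiv.Perm (Fin n)) (s : Fin n) :
    revCycle (revCycle σ s) s = σ := by
  ext x : 1
  by_cases h : σ.SameCycle s x
  · rw [revCycle_apply_of_sameCycle ((sameCycle_revCycle _ _ _ _).2 h),
      Equiv.Perm.inv_eq_iff_eq,
      revCycle_apply_of_sameCycle (Equiv.Perm.sameCycle_apply_right.2 h)]
    exact (σ.symm_apply_apply x).symm
  · rw [revCycle_apply_of_not_sameCycle (mt (sameCycle_revCycle _ _ _ _).1 h),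
      revCycle_apply_of_not_sameCycle h]

theorem colCycleProd_revCycle_of_sameCycle {A : Matrix (Fin n) (Fin n) SplitQuaternion}
    (hA : A.IsHermitian) {σ : Equiv.Perm (Fin n)} {s x : Fin n} (h : σ.SameCycle s x) :
    colCycleProd A (revCycle σ s) x = star (colCycleProd A σ x) := by
  rw [colCycleProd_congr (pow_revCycle_of_sameCycle h) (fun _ _ _ => rfl),
    ← star_rowCycleProd hA, rowCycleProd_inv]

theorem colCycleProd_revCycle_of_not_sameCycle (A : Matrix (Fin n) (Fin n) SplitQuaternion)
    {σ : Equiv.Perm (Fin n)} {s x : Fin n} (h : ¬ σ.SameCycle s x) :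
    colCycleProd A (revCycle σ s) x = colCycleProd A σ x :=
  colCycleProd_congr (pow_revCycle_of_not_sameCycle h) (fun _ _ _ => rfl)

theorem re_colCycleProd_revCycle {A : Matrix (Fin n) (Fin n) SplitQuaternion}
    (hA : A.IsHermitian) (σ : Equiv.Perm (Fin n)) (s x : Fin n) :
    (colCycleProd A (revCycle σ s) x).re = (colCycleProd A σ x).re := by
  by_cases h : σ.SameCycle s x
  · rw [colCycleProd_revCycle_of_sameCycle hA h, QuaternionAlgebra.re_star, zero_mul, add_zero]
  · rw [colCycleProd_revCycle_of_not_sameCycle A h]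

/-- Two sums over all permutations agree as soon as they agree after averaging over the
inversion of the cycle of `s`. -/
theorem sum_eq_of_add_revCycle_eq (s : Fin n) {F G : Equiv.Perm (Fin n) → SplitQuaternion}
    (h : ∀ σ, F σ + F (revCycle σ s) = G σ + G (revCycle σ s)) : ∑ σ, F σ = ∑ σ, G σ := by
  let e : Equiv.Perm (Equiv.Perm (Fin n)) :=
    ⟨fun σ => revCycle σ s, fun σ => revCycle σ s, fun σ => revCycle_revCycle σ s,
      fun σ => revCycle_revCycle σ s⟩
  have key : ∀ H : Equiv.Perm (Fin n) → SplitQuaternion,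
      ∑ σ, (H σ + H (revCycle σ s)) = (2 : ℝ) • ∑ σ, H σ := fun H => by
    rw [Finset.sum_add_distrib, two_smul]
    congr 1
    exact Equiv.sum_comp e H
  have h2 : (2 : ℝ) • ∑ σ, F σ = (2 : ℝ) • ∑ σ, G σ := by
    rw [← key, ← key]
    exact Finset.sum_congr rfl fun σ _ => h σ
  exact smul_right_injective _ (two_ne_zero' ℝ) h2

theorem mem_otherCycleMins {σ : Equiv.Perm (Fin n)} {i s : Fin n} :
    s ∈ otherCycleMins σ i ↔ (∀ t, σ.SameCycle s t → s ≤ t) ∧ ¬ σ.SameCycle i s := by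
  simp [otherCycleMins]

theorem otherCycleMins_congr {σ τ : Equiv.Perm (Fin n)}
    (h : ∀ x y, τ.SameCycle x y ↔ σ.SameCycle x y) (i : Fin n) :
    otherCycleMins τ i = otherCycleMins σ i := by
  simp only [otherCycleMins, h]

theorem eq_of_sameCycle_of_forall_le {σ : Equiv.Perm (Fin n)} {s t : Fin n}
    (hs : ∀ x, σ.SameCycle s x → s ≤ x) (ht : ∀ x, σ.SameCycle t x → t ≤ x)
    (h : σ.SameCycle s t) : s = t :=
  le_antisymm (hs t h) (ht s h.symm)

open scoped Classical in
/-- The product of the real parts of the cycle products of `A` over those cycles of `σ`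
whose least element satisfies `P`. -/
def cycleWeight (A : Matrix (Fin n) (Fin n) SplitQuaternion) (σ : Equiv.Perm (Fin n))
    (P : Fin n → Prop) : ℝ :=
  ∏ s with (∀ t, σ.SameCycle s t → s ≤ t) ∧ P s, (colCycleProd A σ s).re

theorem cycleWeight_congr {A : Matrix (Fin n) (Fin n) SplitQuaternion}
    {σ τ : Equiv.Perm (Fin n)} {P Q : Fin n → Prop} (hPQ : ∀ s, Q s ↔ P s)
    (hst : ∀ s, P s → ∀ t, τ.SameCycle s t ↔ σ.SameCycle s t)
    (hre : ∀ s, P s → (colCycleProd A τ s).re = (colCycleProd A σ s).re) :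
    cycleWeight A τ Q = cycleWeight A σ P := by
  classical
  unfold cycleWeight
  refine Finset.prod_congr (Finset.filter_congr fun s _ => ?_) fun s hs => ?_
  · rw [hPQ]
    refine and_congr_left fun h => ?_
    simp only [hst s h]
  · rw [Finset.mem_filter] at hs
    exact hre s hs.2.2

theorem cycleWeight_revCycle {A : Matrix (Fin n) (Fin n) SplitQuaternion}
    (hA : A.IsHermitian) (σ : Equiv.Perm (Fin n)) (s j : Fin n) :
    cycleWeight A (revCycle σ s) (fun x => ¬ (revCycle σ s).SameCycle j x) =
      cycleWeight A σ (fun x => ¬ σ.SameCycle j x) :=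
  cycleWeight_congr (fun _ => not_congr (sameCycle_revCycle _ _ _ _))
    (fun _ _ _ => sameCycle_revCycle _ _ _ _) (fun _ _ => re_colCycleProd_revCycle hA _ _ _)

/-- A cycle whose elements satisfy `P` contributes exactly one factor to the weight. -/
theorem cycleWeight_eq_mul (A : Matrix (Fin n) (Fin n) SplitQuaternion)
    (σ : Equiv.Perm (Fin n)) (P : Fin n → Prop) (k : Fin n)
    (hP : ∀ s, σ.SameCycle k s → P s) :
    cycleWeight A σ P =
      (colCycleProd A σ k).re * cycleWeight A σ (fun s => P s ∧ ¬ σ.SameCycle k s) := by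
  classical
  obtain ⟨m, hm, hmin⟩ := Finset.exists_min_image (Finset.univ.filter fun s => σ.SameCycle k s)
    id ⟨k, by simpa using Equiv.Perm.SameCycle.refl σ k⟩
  simp only [Finset.mem_filter, Finset.mem_univ, true_and, id] at hm hmin
  have hm' : ∀ t, σ.SameCycle m t → m ≤ t := fun t ht => hmin t (hm.trans ht)
  unfold cycleWeight
  rw [← re_colCycleProd_of_sameCycle A hm]
  refine Eq.trans (Finset.prod_congr ?_ fun _ _ => rfl)
    (Finset.prod_insert (a := m) (f := fun s => (colCycleProd A σ s).re) (by simp [hm]))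
  ext s
  simp only [Finset.mem_filter, Finset.mem_univ, true_and, Finset.mem_insert]
  constructor
  · rintro ⟨hs, hPs⟩
    by_cases hks : σ.SameCycle k s
    · exact Or.inl (eq_of_sameCycle_of_forall_le hs hm' (hks.symm.trans hm))
    · exact Or.inr ⟨hs, hPs, hks⟩
  · rintro (rfl | ⟨hs, hPs, -⟩)
    · exact ⟨hm', hP _ hm⟩
    · exact ⟨hs, hPs⟩

theorem map_re_otherCycleMins_prod (A : Matrix (Fin n) (Fin n) SplitQuaternion)
    (σ : Equiv.Perm (Fin n)) (j : Fin n) :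
    ((otherCycleMins σ j).reverse.map
      (fun s => algebraMap ℝ SplitQuaternion (colCycleProd A σ s).re)).prod =
      algebraMap ℝ SplitQuaternion (cycleWeight A σ (fun s => ¬ σ.SameCycle j s)) := by
  classical
  have h : (otherCycleMins σ j).reverse.map
      (fun s => algebraMap ℝ SplitQuaternion (colCycleProd A σ s).re) =
      ((otherCycleMins σ j).reverse.map (fun s => (colCycleProd A σ s).re)).map
        (algebraMap ℝ SplitQuaternion) := by
    rw [List.map_map]; rfl
  rw [h, ← map_list_prod, List.map_reverse, List.prod_reverse]
  congr 1
  unfold otherCycleMins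
  rw [← List.prod_toFinset _ (Finset.sort_nodup _ _), Finset.sort_toFinset]
  unfold cycleWeight
  congr!

theorem sum_otherCycleMins_eq_cycleWeight {A : Matrix (Fin n) (Fin n) SplitQuaternion}
    (hA : A.IsHermitian) (j : Fin n) (T : Equiv.Perm (Fin n) → SplitQuaternion)
    (hT : ∀ σ s, ¬ σ.SameCycle j s → T (revCycle σ s) = T σ) :
    ∑ σ : Equiv.Perm (Fin n), ((Equiv.Perm.sign σ : ℤ) : SplitQuaternion) *
        (((otherCycleMins σ j).reverse.map (colCycleProd A σ)).prod * T σ) =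
      ∑ σ : Equiv.Perm (Fin n), ((Equiv.Perm.sign σ : ℤ) : SplitQuaternion) *
        (algebraMap ℝ SplitQuaternion (cycleWeight A σ (fun s => ¬ σ.SameCycle j s)) * T σ) := by
  classical
  let g : Finset (Fin n) → Equiv.Perm (Fin n) → Fin n → SplitQuaternion := fun U σ s =>
    if s ∈ U then algebraMap ℝ SplitQuaternion (colCycleProd A σ s).re else colCycleProd A σ s
  have key : ∀ U : Finset (Fin n),
      ∑ σ : Equiv.Perm (Fin n), ((Equiv.Perm.sign σ : ℤ) : SplitQuaternion) *
        (((otherCycleMins σ j).reverse.map (g ∅ σ)).prod * T σ) =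
      ∑ σ : Equiv.Perm (Fin n), ((Equiv.Perm.sign σ : ℤ) : SplitQuaternion) *
        (((otherCycleMins σ j).reverse.map (g U σ)).prod * T σ) := by
    intro U
    induction U using Finset.induction_on with
    | empty => rfl
    | insert m U hmU ih =>
      rw [ih]
      refine sum_eq_of_add_revCycle_eq m fun σ => ?_
      rw [sign_revCycle, otherCycleMins_congr (sameCycle_revCycle σ m)]
      have hne : ∀ τ s, s ≠ m → g (insert m U) τ s = g U τ s := fun τ s hs => by
        simp [g, hs]
      by_cases hm : m ∈ otherCycleMins σ j
      · rw [hT σ m (mem_otherCycleMins.1 hm).2]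
        have hnd : (otherCycleMins σ j).reverse.Nodup :=
          List.nodup_reverse.2 (Finset.sort_nodup _ _)
        have hmem : ∀ s ∈ (otherCycleMins σ j).reverse, ∀ t,
            σ.SameCycle s t → s ≤ t := fun s hs =>
          (mem_otherCycleMins.1 (List.mem_reverse.1 hs)).1
        obtain ⟨l₁, l₂, hl⟩ := List.append_of_mem (List.mem_reverse.2 hm)
        rw [hl] at hnd hmem ⊢
        have hmm : ∀ t, σ.SameCycle m t → m ≤ t := hmem m (by simp)
        have hm₁ : m ∉ l₁ := fun h => (List.nodup_append.1 hnd).2.2 m h m (by simp) rfl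
        have hm₂ : m ∉ l₂ := (List.nodup_cons.1 (List.nodup_append.1 hnd).2.1).1
        have hg : ∀ s, s ≠ m → s ∈ l₁ ++ m :: l₂ → g U (revCycle σ m) s = g U σ s := by
          intro s hsm hs
          have hns : ¬ σ.SameCycle m s := fun H =>
            hsm (eq_of_sameCycle_of_forall_le hmm (hmem s hs) H).symm
          simp only [g, colCycleProd_revCycle_of_not_sameCycle A hns]
        have hl₁ : ∀ s ∈ l₁, s ≠ m := fun s hs h => hm₁ (h ▸ hs)
        have hl₂ : ∀ s ∈ l₂, s ≠ m := fun s hs h => hm₂ (h ▸ hs)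
        have h₁ : l₁.map (g U (revCycle σ m)) = l₁.map (g U σ) :=
          List.map_congr_left fun s hs => hg s (hl₁ s hs) (by simp [hs])
        have h₂ : l₂.map (g U (revCycle σ m)) = l₂.map (g U σ) :=
          List.map_congr_left fun s hs => hg s (hl₂ s hs) (by simp [hs])
        have h₁' : ∀ τ, l₁.map (g (insert m U) τ) = l₁.map (g U τ) := fun τ =>
          List.map_congr_left fun s hs => hne τ s (hl₁ s hs)
        have h₂' : ∀ τ, l₂.map (g (insert m U) τ) = l₂.map (g U τ) := fun τ =>
          List.map_congr_left fun s hs => hne τ s (hl₂ s hs)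
        have hsum : g U σ m + g U (revCycle σ m) m =
            g (insert m U) σ m + g (insert m U) (revCycle σ m) m := by
          simp only [g, hmU, if_false, Finset.mem_insert_self, if_true,
            QuaternionAlgebra.re_star, zero_mul, add_zero,
            colCycleProd_revCycle_of_sameCycle hA (Equiv.Perm.SameCycle.refl σ m)]
          rw [add_star_eq, two_mul, map_add]
        simp only [List.map_append, List.map_cons, List.prod_append, List.prod_cons, h₁, h₂,
          h₁', h₂']
        rw [← mul_add, ← mul_add, ← add_mul, ← add_mul, ← mul_add, ← mul_add, ← add_mul,
          ← add_mul, hsum]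
      · have hl : ∀ s ∈ (otherCycleMins σ j).reverse, s ≠ m := fun s hs h =>
          hm (h ▸ List.mem_reverse.1 hs)
        have h' : ∀ τ, (otherCycleMins σ j).reverse.map (g (insert m U) τ) =
            (otherCycleMins σ j).reverse.map (g U τ) := fun τ =>
          List.map_congr_left fun s hs => hne τ s (hl s hs)
        rw [h', h']
  refine Eq.trans ?_ ((key Finset.univ).trans ?_)
  · simp [g]
  · simp only [g, Finset.mem_univ, if_true, map_re_otherCycleMins_prod]

/-- The column determinant along a replaced column, with all cycles avoiding that column
replaced by their real parts. -/
theorem cdet_updateCol {A : Matrix (Fin n) (Fin n) SplitQuaternion} (hA : A.IsHermitian)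
    (j : Fin n) (y : Fin n → SplitQuaternion) :
    cdet (A.updateCol j y) j =
      ∑ σ : Equiv.Perm (Fin n), ((Equiv.Perm.sign σ : ℤ) : SplitQuaternion) *
        (algebraMap ℝ SplitQuaternion (cycleWeight A σ (fun s => ¬ σ.SameCycle j s)) *
          colCycleProd (A.updateCol j y) σ j) := by
  rw [← sum_otherCycleMins_eq_cycleWeight hA]
  · unfold cdet
    refine Finset.sum_congr rfl fun σ _ => ?_
    congr 3
    refine List.map_congr_left fun s hs => ?_
    exact colCycleProd_updateCol_of_not_sameCycle A y
      (mem_otherCycleMins.1 (List.mem_reverse.1 hs)).2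
  · intro σ s hs
    exact colCycleProd_revCycle_of_not_sameCycle _ fun H => hs H.symm

/-- The real number `∑ σ, sign σ * ∏ Re c`, with `c` ranging over the cycle products of `σ`;
it is the common value of all row and column determinants of a Hermitian matrix. -/
def realDet (A : Matrix (Fin n) (Fin n) SplitQuaternion) : ℝ :=
  ∑ σ : Equiv.Perm (Fin n), (Equiv.Perm.sign σ : ℤ) * cycleWeight A σ (fun _ => True)

theorem cdet_eq_realDet {A : Matrix (Fin n) (Fin n) SplitQuaternion} (hA : A.IsHermitian)
    (j : Fin n) : cdet A j = algebraMap ℝ SplitQuaternion (realDet A) := by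
  have h := cdet_updateCol hA j (fun i => A i j)
  have hself : A.updateCol j (fun i => A i j) = A := Matrix.updateCol_eq_self A j
  rw [hself] at h
  rw [h, realDet, map_sum]
  refine sum_eq_of_add_revCycle_eq j fun σ => ?_
  have hw : ∀ τ : Equiv.Perm (Fin n), cycleWeight A τ (fun _ => True) =
      (colCycleProd A τ j).re * cycleWeight A τ (fun s => ¬ τ.SameCycle j s) := fun τ => by
    rw [cycleWeight_eq_mul A τ _ j (fun _ _ => trivial)]
    simp only [true_and]
  rw [hw, hw, sign_revCycle, cycleWeight_revCycle hA, re_colCycleProd_revCycle hA,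
    colCycleProd_revCycle_of_sameCycle hA (Equiv.Perm.SameCycle.refl σ j), ← mul_add, ← mul_add,
    add_star_eq]
  rw [← map_intCast (algebraMap ℝ SplitQuaternion), ← map_mul, ← map_mul, ← map_add]
  congr 1
  ring

theorem rdet_eq_star_cdet {A : Matrix (Fin n) (Fin n) SplitQuaternion} (hA : A.IsHermitian)
    (i : Fin n) : rdet A i = star (cdet A i) := by
  have hs : ∀ l : List (Fin n), ∀ σ, star ((l.reverse.map (colCycleProd A σ)).prod) =
      (l.map (rowCycleProd A σ)).prod := by
    intro l σ
    induction l with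
    | nil => simp
    | cons a l ih =>
      rw [List.reverse_cons, List.map_append, List.prod_append, star_mul, ih]
      simp [← star_rowCycleProd hA]
  have hint : ∀ z : ℤ, star (z : SplitQuaternion) = z := fun z => star_intCast z
  unfold rdet cdet
  rw [star_sum]
  refine Finset.sum_congr rfl fun σ _ => ?_
  rw [star_mul, star_mul, hs, hint, ← star_rowCycleProd hA, star_star, Int.cast_comm]

theorem hdet_eq_realDet [NeZero n] {A : Matrix (Fin n) (Fin n) SplitQuaternion}
    (hA : A.IsHermitian) : hdet A = algebraMap ℝ SplitQuaternion (realDet A) := by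
  rw [hdet, rdet_eq_star_cdet hA, cdet_eq_realDet hA, QuaternionAlgebra.coe_algebraMap,
    QuaternionAlgebra.star_coe]

section Merge

variable {τ : Equiv.Perm (Fin n)} {j k : Fin n}

theorem pow_mul_swap_right (h : ¬ τ.SameCycle j k) {m : ℕ} (hm : m < Function.minimalPeriod τ k) :
    ((τ * Equiv.swap j k) ^ (m + 1)) j = (τ ^ (m + 1)) k := by
  induction m with
  | zero => simp
  | succ m ih =>
    rw [pow_succ', Equiv.Perm.mul_apply, ih (by omega), pow_succ' _ (m + 1),
      Equiv.Perm.mul_apply, Equiv.Perm.mul_apply, Equiv.swap_apply_of_ne_of_ne]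
    · intro H
      apply h
      rw [← H]
      exact (Equiv.Perm.sameCycle_pow_left.2 (Equiv.Perm.SameCycle.refl _ _))
    · intro H
      refine Function.not_isPeriodicPt_of_pos_of_lt_minimalPeriod (Nat.succ_ne_zero m) hm ?_
      rwa [Function.IsPeriodicPt, Function.IsFixedPt, ← pow_apply_eq_iterate]

theorem pow_mul_swap_minimalPeriod (h : ¬ τ.SameCycle j k) :
    ((τ * Equiv.swap j k) ^ Function.minimalPeriod τ k) j = k := by
  obtain ⟨L, hL⟩ := Nat.exists_eq_succ_of_ne_zero (minimalPeriod_pos τ k).ne'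
  rw [hL, Nat.succ_eq_add_one, pow_mul_swap_right h (by omega)]
  have := pow_minimalPeriod_apply τ k
  rwa [hL] at this

theorem pow_mul_swap_left (h : ¬ τ.SameCycle j k) {m : ℕ} (hm : m < Function.minimalPeriod τ j) :
    ((τ * Equiv.swap j k) ^ (Function.minimalPeriod τ k + (m + 1))) j = (τ ^ (m + 1)) j := by
  rw [add_comm, pow_add, Equiv.Perm.mul_apply, pow_mul_swap_minimalPeriod h,
    Equiv.swap_comm]
  exact pow_mul_swap_right (fun H => h H.symm) hm

theorem sameCycle_mul_swap (h : ¬ τ.SameCycle j k) : (τ * Equiv.swap j k).SameCycle j k :=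
  ⟨Function.minimalPeriod τ k, by rw [zpow_natCast]; exact pow_mul_swap_minimalPeriod h⟩

theorem minimalPeriod_mul_swap (h : ¬ τ.SameCycle j k) :
    Function.minimalPeriod (τ * Equiv.swap j k : Equiv.Perm (Fin n)) j =
      Function.minimalPeriod τ k + Function.minimalPeriod τ j := by
  have hpj := minimalPeriod_pos τ j
  have hpk := minimalPeriod_pos τ k
  have hp := minimalPeriod_pos (τ * Equiv.swap j k) j
  have hfix := pow_minimalPeriod_apply (τ * Equiv.swap j k) j
  apply le_antisymm
  · apply Function.IsPeriodicPt.minimalPeriod_le (by omega)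
    rw [Function.IsPeriodicPt, Function.IsFixedPt, ← pow_apply_eq_iterate]
    obtain ⟨L, hL⟩ := Nat.exists_eq_succ_of_ne_zero hpj.ne'
    have h1 := pow_mul_swap_left h (m := L) (by omega)
    have h2 := pow_minimalPeriod_apply τ j
    rw [hL, Nat.succ_eq_add_one] at h2 ⊢
    rw [h1, h2]
  · by_contra! hlt
    set p := Function.minimalPeriod (τ * Equiv.swap j k : Equiv.Perm (Fin n)) j with hpdef
    rcases le_or_gt p (Function.minimalPeriod τ k) with hle | hgt
    · obtain ⟨m, hm⟩ := Nat.exists_eq_succ_of_ne_zero hp.ne'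
      rw [hm, Nat.succ_eq_add_one, pow_mul_swap_right h (by omega)] at hfix
      apply h
      nth_rewrite 1 [← hfix]
      exact Equiv.Perm.sameCycle_pow_left.2 (Equiv.Perm.SameCycle.refl _ _)
    · obtain ⟨m, hm⟩ := Nat.exists_eq_add_of_lt hgt
      rw [hm, add_assoc, pow_mul_swap_left h (by omega)] at hfix
      refine Function.not_isPeriodicPt_of_pos_of_lt_minimalPeriod (Nat.succ_ne_zero m)
        (by omega : m + 1 < Function.minimalPeriod τ j) ?_
      rwa [Function.IsPeriodicPt, Function.IsFixedPt, ← pow_apply_eq_iterate]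

theorem not_sameCycle_mul_swap {σ : Equiv.Perm (Fin n)} (hjk : j ≠ k) (h : σ.SameCycle j k) :
    ¬ (σ * Equiv.swap j k).SameCycle j k := by
  classical
  have hex : ∃ m : ℕ, (σ ^ (m + 1)) j = k := by
    obtain ⟨m, hm⟩ := h.exists_nat_pow_eq
    cases m with
    | zero => exact absurd hm hjk
    | succ m => exact ⟨m, hm⟩
  obtain ⟨hm, hmin⟩ := (⟨Nat.find_spec hex, fun _ hi => Nat.find_min hex hi⟩ :
    (σ ^ (Nat.find hex + 1)) j = k ∧ ∀ i < Nat.find hex, ¬ (σ ^ (i + 1)) j = k)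
  set m := Nat.find hex
  have hj : ∀ i < m, (σ ^ (i + 1)) j ≠ j := by
    intro i hi hij
    refine hmin (m - (i + 1)) (by omega) ?_
    rw [← hm]
    conv_lhs => rw [← hij]
    rw [← Equiv.Perm.mul_apply, ← pow_add]
    congr 2
    omega
  have hpow : ∀ i ≤ m, ((σ * Equiv.swap j k) ^ (i + 1)) k = (σ ^ (i + 1)) j := by
    intro i hi
    induction i with
    | zero => simp
    | succ i ih =>
      rw [pow_succ', Equiv.Perm.mul_apply, ih (by omega), Equiv.Perm.mul_apply,
        Equiv.swap_apply_of_ne_of_ne (hj i (by omega)) (hmin i (by omega)), pow_succ' _ (i + 1),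
        Equiv.Perm.mul_apply]
  intro H
  obtain ⟨i, hi⟩ := H.symm.exists_nat_pow_eq
  have hper : Function.IsPeriodicPt (σ * Equiv.swap j k : Equiv.Perm (Fin n)) (m + 1) k := by
    rw [Function.IsPeriodicPt, Function.IsFixedPt, ← pow_apply_eq_iterate, hpow m le_rfl, hm]
  rw [pow_apply_eq_iterate, ← hper.iterate_mod_apply, ← pow_apply_eq_iterate] at hi
  have hlt := Nat.mod_lt i (Nat.succ_pos m)
  generalize i % (m + 1) = r at hi hlt
  cases r with
  | zero => exact hjk hi.symm
  | succ r =>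
    rw [hpow r (by omega)] at hi
    exact hj r (by omega) hi

theorem pow_mul_swap_of_not_sameCycle {s : Fin n} (hj : ¬ τ.SameCycle j s)
    (hk : ¬ τ.SameCycle k s) (m : ℕ) : ((τ * Equiv.swap j k) ^ m) s = (τ ^ m) s := by
  refine pow_apply_congr (fun x hx => ?_) m
  rw [Equiv.Perm.mul_apply, Equiv.swap_apply_of_ne_of_ne]
  · rintro rfl
    exact hj hx.symm
  · rintro rfl
    exact hk hx.symm

theorem sameCycle_mul_swap_iff (h : ¬ τ.SameCycle j k) (s : Fin n) :
    (τ * Equiv.swap j k).SameCycle j s ↔ τ.SameCycle j s ∨ τ.SameCycle k s := by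
  constructor
  · intro H
    by_contra! hs
    have H' := (sameCycle_congr (pow_mul_swap_of_not_sameCycle hs.1 hs.2) j).1 H.symm
    exact hs.1 H'.symm
  · have aux : ∀ {a b : Fin n}, ¬ τ.SameCycle a b → τ.SameCycle b s →
        (τ * Equiv.swap a b).SameCycle a s := by
      intro a b hab hs
      obtain ⟨i, hi⟩ := hs.exists_nat_pow_eq
      rw [pow_apply_eq_iterate, ← Function.iterate_mod_minimalPeriod_eq,
        ← pow_apply_eq_iterate] at hi
      have hlt := Nat.mod_lt i (minimalPeriod_pos τ b)
      generalize i % Function.minimalPeriod τ b = r at hi hlt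
      cases r with
      | zero =>
        have : b = s := hi
        exact this ▸ sameCycle_mul_swap hab
      | succ r =>
        rw [← hi, ← pow_mul_swap_right hab (by omega)]
        exact Equiv.Perm.sameCycle_pow_right.2 (Equiv.Perm.SameCycle.refl _ _)
    rintro (hs | hs)
    · have := aux (fun H => h H.symm) hs
      rw [Equiv.swap_comm] at this
      exact (sameCycle_mul_swap h).trans this
    · exact aux h hs

/-- Merging the cycles of `j` and `k` concatenates the path from `k` to `j` with the closed
cycle at `k`. -/
theorem colCycleProd_mul_swap (A : Matrix (Fin n) (Fin n) SplitQuaternion)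
    (h : ¬ τ.SameCycle j k) :
    colCycleProd (A.updateCol j fun i => A i k) (τ * Equiv.swap j k) j =
      colCycleProd (A.updateCol j fun i => A i k) τ j * colCycleProd A τ k := by
  unfold colCycleProd
  rw [minimalPeriod_mul_swap h, List.range_add, List.map_append, List.reverse_append,
    List.prod_append, List.map_map]
  congr 3
  · refine List.map_congr_left fun m hm => ?_
    rw [List.mem_range] at hm
    rw [Function.comp_apply, add_assoc, pow_mul_swap_left h hm]
    cases m with
    | zero =>
      rw [add_zero, pow_mul_swap_minimalPeriod h, pow_zero, Equiv.Perm.one_apply,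
        Matrix.updateCol_self, Matrix.updateCol_ne]
      rintro rfl
      exact h (Equiv.Perm.SameCycle.refl _ _)
    | succ m => rw [pow_mul_swap_left h (by omega)]
  · refine List.map_congr_left fun m hm => ?_
    rw [List.mem_range] at hm
    rw [pow_mul_swap_right h hm]
    cases m with
    | zero => rw [pow_zero, pow_zero, Equiv.Perm.one_apply, Equiv.Perm.one_apply,
        Matrix.updateCol_self]
    | succ m =>
      rw [pow_mul_swap_right h (by omega), Matrix.updateCol_ne]
      intro H
      apply h
      rw [← H]
      exact Equiv.Perm.sameCycle_pow_left.2 (Equiv.Perm.SameCycle.refl _ _)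

theorem cycleWeight_mul_swap (A : Matrix (Fin n) (Fin n) SplitQuaternion)
    (h : ¬ τ.SameCycle j k) :
    cycleWeight A (τ * Equiv.swap j k) (fun s => ¬ (τ * Equiv.swap j k).SameCycle j s) =
      cycleWeight A τ (fun s => ¬ τ.SameCycle j s ∧ ¬ τ.SameCycle k s) :=
  cycleWeight_congr (fun s => by rw [sameCycle_mul_swap_iff h, not_or])
    (fun _ hs => sameCycle_congr (pow_mul_swap_of_not_sameCycle hs.1 hs.2))
    (fun _ hs => by
      rw [colCycleProd_congr (pow_mul_swap_of_not_sameCycle hs.1 hs.2) fun _ _ _ => rfl])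

end Merge

/-- Replacing column `j` of a Hermitian matrix by another of its columns annihilates the
`j`-th column determinant. -/
theorem cdet_updateCol_eq_zero {A : Matrix (Fin n) (Fin n) SplitQuaternion}
    (hA : A.IsHermitian) {j k : Fin n} (hjk : j ≠ k) :
    cdet (A.updateCol j fun i => A i k) j = 0 := by
  classical
  rw [cdet_updateCol hA]
  set B := A.updateCol j fun i => A i k with hB
  let F : Equiv.Perm (Fin n) → SplitQuaternion := fun σ =>
    ((Equiv.Perm.sign σ : ℤ) : SplitQuaternion) *
      (algebraMap ℝ SplitQuaternion (cycleWeight A σ (fun s => ¬ σ.SameCycle j s)) *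
        colCycleProd B σ j)
  change ∑ σ, F σ = 0
  have hmerge : ∑ σ with σ.SameCycle j k, F σ =
      ∑ τ with ¬ τ.SameCycle j k, F (τ * Equiv.swap j k) := by
    refine Finset.sum_bij' (fun σ _ => σ * Equiv.swap j k) (fun τ _ => τ * Equiv.swap j k)
      ?_ ?_ ?_ ?_ ?_
    · intro σ hσ
      simp only [Finset.mem_filter, Finset.mem_univ, true_and] at hσ ⊢
      exact not_sameCycle_mul_swap hjk hσ
    · intro τ hτ
      simp only [Finset.mem_filter, Finset.mem_univ, true_and] at hτ ⊢
      exact sameCycle_mul_swap hτ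
    · intro σ _; simp [mul_assoc]
    · intro σ _; simp [mul_assoc]
    · intro σ _; simp [mul_assoc]
  rw [← Finset.sum_filter_add_sum_filter_not Finset.univ (fun σ => σ.SameCycle j k), hmerge,
    ← Finset.sum_add_distrib, Finset.sum_filter]
  refine (sum_eq_of_add_revCycle_eq k (G := fun _ => 0) fun τ => ?_).trans Finset.sum_const_zero
  simp only [sameCycle_revCycle]
  by_cases h : τ.SameCycle j k
  · simp only [h, not_true_eq_false, if_false]
  simp only [h, not_false_eq_true, if_true]
  have hW : ∀ π : Equiv.Perm (Fin n), ¬ π.SameCycle j k →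
      cycleWeight A π (fun s => ¬ π.SameCycle j s) = (colCycleProd A π k).re *
        cycleWeight A π (fun s => ¬ π.SameCycle j s ∧ ¬ π.SameCycle k s) := fun π hπ =>
    cycleWeight_eq_mul A π _ k fun s hs H => hπ (H.trans hs.symm)
  have hF : ∀ π : Equiv.Perm (Fin n), ¬ π.SameCycle j k →
      F (π * Equiv.swap j k) + F π = ((Equiv.Perm.sign π : ℤ) : SplitQuaternion) *
        (algebraMap ℝ SplitQuaternion
          (cycleWeight A π (fun s => ¬ π.SameCycle j s ∧ ¬ π.SameCycle k s)) *
          (colCycleProd B π j *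
            (algebraMap ℝ SplitQuaternion (colCycleProd A π k).re - colCycleProd A π k))) := by
    intro π hπ
    simp only [F]
    rw [cycleWeight_mul_swap A hπ, hB, colCycleProd_mul_swap A hπ, hW π hπ, map_mul, map_mul,
      Equiv.Perm.sign_swap hjk, mul_neg_one, Units.val_neg, Int.cast_neg,
      Algebra.commutes (colCycleProd A π k).re, mul_assoc (algebraMap ℝ SplitQuaternion _),
      Algebra.commutes (colCycleProd A π k).re, mul_sub, mul_sub, mul_sub, neg_mul,
      neg_add_eq_sub]
  have h' : ¬ (revCycle τ k).SameCycle j k := mt (sameCycle_revCycle _ _ _ _).1 h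
  have hkj : ¬ τ.SameCycle k j := fun H => h H.symm
  have hw : cycleWeight A (revCycle τ k)
      (fun s => ¬ (revCycle τ k).SameCycle j s ∧ ¬ (revCycle τ k).SameCycle k s) =
      cycleWeight A τ (fun s => ¬ τ.SameCycle j s ∧ ¬ τ.SameCycle k s) :=
    cycleWeight_congr (fun _ => by rw [sameCycle_revCycle, sameCycle_revCycle])
      (fun _ _ _ => sameCycle_revCycle _ _ _ _) (fun _ _ => re_colCycleProd_revCycle hA _ _ _)
  rw [hF τ h, hF _ h', hw, sign_revCycle, re_colCycleProd_revCycle hA,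
    colCycleProd_revCycle_of_not_sameCycle B hkj,
    colCycleProd_revCycle_of_sameCycle hA (Equiv.Perm.SameCycle.refl τ k), ← mul_add, ← mul_add,
    ← mul_add, sub_add_sub_comm, add_star_eq, two_mul, map_add, sub_self, mul_zero, mul_zero,
    mul_zero, add_zero]

/-- The left cofactors of a Hermitian matrix `A`: the coefficients of the expansion of
`cdet_j A_{.j}(y)` in the entries of `y`. -/
def cofactor (A : Matrix (Fin n) (Fin n) SplitQuaternion) :
    Matrix (Fin n) (Fin n) SplitQuaternion := fun j i =>
  ∑ σ : Equiv.Perm (Fin n) with σ j = i, ((Equiv.Perm.sign σ : ℤ) : SplitQuaternion) *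
    (algebraMap ℝ SplitQuaternion (cycleWeight A σ (fun s => ¬ σ.SameCycle j s)) *
      cyclePath A σ j)

theorem cdet_updateCol_eq_mulVec {A : Matrix (Fin n) (Fin n) SplitQuaternion}
    (hA : A.IsHermitian) (j : Fin n) (y : Fin n → SplitQuaternion) :
    cdet (A.updateCol j y) j = (cofactor A).mulVec y j := by
  rw [cdet_updateCol hA, Matrix.mulVec, dotProduct, ← Finset.sum_fiberwise Finset.univ
    (fun σ : Equiv.Perm (Fin n) => σ j)]
  refine Finset.sum_congr rfl fun i _ => ?_
  rw [cofactor, Finset.sum_mul]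
  refine Finset.sum_congr rfl fun σ hσ => ?_
  rw [Finset.mem_filter] at hσ
  rw [colCycleProd_updateCol, hσ.2]
  simp only [mul_assoc]

theorem cofactor_mul {A : Matrix (Fin n) (Fin n) SplitQuaternion} (hA : A.IsHermitian) :
    cofactor A * A = realDet A • (1 : Matrix (Fin n) (Fin n) SplitQuaternion) := by
  ext1 j k
  have h : (cofactor A * A) j k = cdet (A.updateCol j fun i => A i k) j := by
    rw [cdet_updateCol_eq_mulVec hA]; rfl
  rw [h]
  by_cases hjk : j = k
  · subst hjk
    have hself : A.updateCol j (fun i => A i j) = A := Matrix.updateCol_eq_self A j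
    rw [hself, cdet_eq_realDet hA, Matrix.smul_apply, Matrix.one_apply_eq,
      Algebra.algebraMap_eq_smul_one]
  · rw [cdet_updateCol_eq_zero hA hjk, Matrix.smul_apply, Matrix.one_apply_ne hjk, smul_zero]

theorem mul_conjTranspose_cofactor {A : Matrix (Fin n) (Fin n) SplitQuaternion}
    (hA : A.IsHermitian) :
    A * (cofactor A).conjTranspose =
      realDet A • (1 : Matrix (Fin n) (Fin n) SplitQuaternion) := by
  have h := congrArg Matrix.conjTranspose (cofactor_mul hA)
  rw [Matrix.conjTranspose_mul, hA.eq] at h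
  rw [h]
  ext1 i k
  rw [Matrix.conjTranspose_apply, Matrix.smul_apply, Matrix.smul_apply,
    QuaternionAlgebra.star_smul, Matrix.one_apply, Matrix.one_apply]
  split_ifs <;> simp_all

/-- Cramer's rule for a right system `A·x = y` with Hermitian matrix of coefficients
`A` such that `det A ≠ 0`: the system has a unique solution, given componentwise by
`x_j = cdet_j A_{.j}(y) / det A`. -/
theorem cramer_right_system [NeZero n]
    (A : Matrix (Fin n) (Fin n) SplitQuaternion) (hA : A.IsHermitian)
    (hd : hdet A ≠ 0) (y : Fin n → SplitQuaternion) :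
    (∃! x : Fin n → SplitQuaternion, A.mulVec x = y) ∧
    (∀ x : Fin n → SplitQuaternion, A.mulVec x = y →
      ∀ j : Fin n, x j = ((hdet A).re)⁻¹ • cdet (A.updateCol j y) j) := by
  have hreal := hdet_eq_realDet hA
  have hre : (hdet A).re = realDet A := by
    rw [hreal, QuaternionAlgebra.coe_algebraMap, QuaternionAlgebra.re_coe]
  have hne : realDet A ≠ 0 := fun h => hd (by rw [hreal, h, map_zero])
  have hsol : ∀ x : Fin n → SplitQuaternion, A.mulVec x = y →
      ∀ j : Fin n, x j = ((hdet A).re)⁻¹ • cdet (A.updateCol j y) j := by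
    rintro x rfl j
    rw [cdet_updateCol_eq_mulVec hA, Matrix.mulVec_mulVec, cofactor_mul hA, Matrix.smul_mulVec,
      Matrix.one_mulVec, hre, Pi.smul_apply, inv_smul_smul₀ hne]
  have hex : A.mulVec ((realDet A)⁻¹ • (cofactor A).conjTranspose.mulVec y) = y := by
    rw [Matrix.mulVec_smul, Matrix.mulVec_mulVec, mul_conjTranspose_cofactor hA,
      Matrix.smul_mulVec, Matrix.one_mulVec, inv_smul_smul₀ hne]
  exact ⟨⟨_, hex, fun x hx => funext fun j => (hsol x hx j).trans (hsol _ hex j).symm⟩, hsol⟩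

end SplitQuaternion

end
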